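/- The function x ↦ (5x³ − x)/((x − i)^5 (x + i)^2) is integrable on ℝ and ∫_{-∞}^{+∞} (5x³ − x)/((x − i)^5 (x + i)^2) dx = −π/16. -/

import Mathlib

open Complex MeasureTheory Real

open Filter Topology

lemma ofReal_sub_I_ne_zero (x : ℝ) : (x : ℂ) - I ≠ 0 := fun h => by
  simpa using congrArg Complex.im h

lemma ofReal_add_I_ne_zero (x : ℝ) : (x : ℂ) + I ≠ 0 := fun h => by
  simpa using congrArg Complex.im h

lemma norm_ofReal_sub_I (x : ℝ) : ‖(x : ℂ) - I‖ = √(1 + x ^ 2) := by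
  rw [Complex.norm_eq_sqrt_sq_add_sq]
  simp [add_comm]

lemma norm_ofReal_add_I (x : ℝ) : ‖(x : ℂ) + I‖ = √(1 + x ^ 2) := by
  rw [Complex.norm_eq_sqrt_sq_add_sq]
  simp [add_comm]

lemma tendsto_inv_ofReal_add {l : Filter ℝ} (hl : Tendsto (fun x : ℝ => ‖x‖) l atTop) (c : ℂ) :
    Tendsto (fun x : ℝ => ((x : ℂ) + c)⁻¹) l (𝓝 0) := by
  refine tendsto_inv₀_cobounded.comp (tendsto_norm_atTop_iff_cobounded.mp ?_)
  refine tendsto_atTop_mono (fun x => ?_) (tendsto_atTop_add_const_right l (-‖c‖) hl)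
  have h := norm_sub_le ((x : ℂ) + c) c
  rw [add_sub_cancel_right, Complex.norm_real] at h
  linarith

lemma integrable_rational :
    Integrable (fun x : ℝ => (5 * (x : ℂ) ^ 3 - (x : ℂ)) /
      ((((x : ℂ) - I) ^ 5) * (((x : ℂ) + I) ^ 2))) := by
  refine (integrable_inv_one_add_sq.const_mul 5).mono' (Continuous.aestronglyMeasurable ?_)
    (ae_of_all _ fun x => ?_)
  · refine Continuous.div (by fun_prop) (by fun_prop) fun x => ?_
    exact mul_ne_zero (pow_ne_zero _ (ofReal_sub_I_ne_zero x))
      (pow_ne_zero _ (ofReal_add_I_ne_zero x))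
  · rw [norm_div, norm_mul, norm_pow, norm_pow, norm_ofReal_sub_I, norm_ofReal_add_I]
    have hnum : ‖5 * (x : ℂ) ^ 3 - (x : ℂ)‖ = |x| * |5 * x ^ 2 - 1| := by
      rw [← abs_mul, ← Real.norm_eq_abs, ← Complex.norm_real]
      push_cast
      ring_nf
    have hr : √(1 + x ^ 2) ^ 2 = 1 + x ^ 2 := Real.sq_sqrt (by positivity)
    have hr1 : 1 ≤ √(1 + x ^ 2) := Real.one_le_sqrt.mpr (by nlinarith [sq_nonneg x])
    have hx : |x| ≤ √(1 + x ^ 2) := Real.abs_le_sqrt (by linarith)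
    have hq : |5 * x ^ 2 - 1| ≤ 5 * √(1 + x ^ 2) ^ 2 := by
      rw [hr, abs_le]
      constructor <;> nlinarith [sq_nonneg x]
    have hinv : (1 + x ^ 2)⁻¹ = (√(1 + x ^ 2) ^ 2)⁻¹ := by rw [hr]
    rw [hnum, hinv]
    set r := √(1 + x ^ 2)
    have hr0 : 0 < r := by linarith
    rw [div_le_iff₀ (by positivity)]
    calc |x| * |5 * x ^ 2 - 1| ≤ r * (5 * r ^ 2) := by gcongr
      _ = 5 * r ^ 3 := by ring
      _ ≤ 5 * r ^ 5 := by gcongr; norm_num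
      _ = 5 * (r ^ 2)⁻¹ * (r ^ 5 * r ^ 2) := by field_simp

/-- A primitive on the real line of `(5 x ^ 3 - x) / ((x - I) ^ 5 * (x + I) ^ 2)`. -/
noncomputable def rationalPrimitive (x : ℝ) : ℂ :=
  -(1 / 16) * (Real.arctan x : ℂ) +
    (-(3 * I / 8) * ((x : ℂ) - I)⁻¹ ^ 4 - 5 / 6 * ((x : ℂ) - I)⁻¹ ^ 3 +
      7 * I / 16 * ((x : ℂ) - I)⁻¹ ^ 2 - 1 / 4 * ((x : ℂ) - I)⁻¹ + 3 / 16 * ((x : ℂ) + I)⁻¹)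

lemma hasDerivAt_rationalPrimitive (x : ℝ) :
    HasDerivAt rationalPrimitive ((5 * (x : ℂ) ^ 3 - (x : ℂ)) /
      ((((x : ℂ) - I) ^ 5) * (((x : ℂ) + I) ^ 2))) x := by
  have hm := ofReal_sub_I_ne_zero x
  have hp := ofReal_add_I_ne_zero x
  have hid : HasDerivAt (fun y : ℝ => (y : ℂ)) 1 x := by
    simpa using (hasDerivAt_id x).ofReal_comp
  have hu := (hid.sub_const I).fun_inv hm
  have hv := (hid.add_const I).fun_inv hp
  have ha := (Real.hasDerivAt_arctan x).ofReal_comp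
  have h := (ha.const_mul (-(1 / 16) : ℂ)).add
    ((((((hu.fun_pow 4).const_mul (-(3 * I / 8))).sub ((hu.fun_pow 3).const_mul (5 / 6))).add
      ((hu.fun_pow 2).const_mul (7 * I / 16))).sub (hu.const_mul (1 / 4))).add
      (hv.const_mul (3 / 16)))
  refine h.congr_deriv ?_
  have hs : (1 : ℂ) + (x : ℂ) ^ 2 = ((x : ℂ) - I) * ((x : ℂ) + I) := by
    linear_combination I_sq
  push_cast
  rw [hs]
  field_simp
  generalize (x : ℂ) = z
  ring_nf
  have hI5 : I ^ 5 = I := by rw [I_pow_eq_pow_mod]; simp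
  simp only [I_sq, I_pow_three, I_pow_four, hI5]
  ring

lemma tendsto_rationalPrimitive {l : Filter ℝ} {a : ℝ}
    (hl : Tendsto (fun x : ℝ => ‖x‖) l atTop) (ha : Tendsto Real.arctan l (𝓝 a)) :
    Tendsto rationalPrimitive l (𝓝 (-(1 / 16) * (a : ℂ))) := by
  have hu : Tendsto (fun x : ℝ => ((x : ℂ) - I)⁻¹) l (𝓝 0) := by
    simpa only [sub_eq_add_neg] using tendsto_inv_ofReal_add hl (-I)
  have hv := tendsto_inv_ofReal_add hl I
  have ha' := (Complex.continuous_ofReal.tendsto a).comp ha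
  have h := (ha'.const_mul (-(1 / 16) : ℂ)).add
    ((((((hu.pow 4).const_mul (-(3 * I / 8))).sub ((hu.pow 3).const_mul (5 / 6))).add
      ((hu.pow 2).const_mul (7 * I / 16))).sub (hu.const_mul (1 / 4))).add
      (hv.const_mul (3 / 16)))
  have hlim : -(1 / 16) * (a : ℂ) = -(1 / 16) * (a : ℂ) + (-(3 * I / 8) * 0 ^ 4 - 5 / 6 * 0 ^ 3 +
      7 * I / 16 * 0 ^ 2 - 1 / 4 * 0 + 3 / 16 * 0) := by ring
  rw [hlim]
  exact h

theorem stmt5 :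
    Integrable (fun x : ℝ => (5 * (x : ℂ) ^ 3 - (x : ℂ)) / ((((x : ℂ) - I) ^ 5) * (((x : ℂ) + I) ^ 2))) ∧
      ∫ x : ℝ, (5 * (x : ℂ) ^ 3 - (x : ℂ)) / ((((x : ℂ) - I) ^ 5) * (((x : ℂ) + I) ^ 2)) = -(π : ℂ) / 16 := by
  refine ⟨integrable_rational, ?_⟩
  rw [integral_of_hasDerivAt_of_tendsto hasDerivAt_rationalPrimitive integrable_rational
    (tendsto_rationalPrimitive tendsto_abs_atBot_atTop
      (Real.tendsto_arctan_atBot.mono_right nhdsWithin_le_nhds))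
    (tendsto_rationalPrimitive tendsto_abs_atTop_atTop
      (Real.tendsto_arctan_atTop.mono_right nhdsWithin_le_nhds))]
  push_cast
  ring
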